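/- There exists g ∈ D_m(I) such that for every dynamical system (X,f) with X having at least two points, the g-fuzzification f̃_g is not transitive on (F^1(X), d_∞) (and consequently not weakly mixing). -/

import Mathlib

noncomputable section

open Set Metric

/-- The unit interval `I = [0,1]` as a subset of `ℝ`. -/
def I01 : Set ℝ := Set.Icc 0 1

/-- `g ∈ D_m(I)`: `g : I → I` is nondecreasing, right-continuous, `g 0 = 0`, `g 1 = 1`. -/
def Dm (g : ℝ → ℝ) : Prop :=
  MonotoneOn g I01 ∧
  (∀ x ∈ I01, ContinuousWithinAt g (I01 ∩ Set.Ici x) x) ∧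
  Set.MapsTo g I01 I01 ∧ g 0 = 0 ∧ g 1 = 1

/-- `ξ_g x = min g⁻¹([x,1])` (the min exists by right-continuity; `sInf` here). -/
def xiG (g : ℝ → ℝ) (x : ℝ) : ℝ := sInf {t | t ∈ I01 ∧ x ≤ g t}

/-- The `α`-cut `[A]_α` of a fuzzy set `A`. -/
def cut {X : Type*} (A : X → ℝ) (α : ℝ) : Set X := {x | α ≤ A x}

/-- The support of a fuzzy set. -/
def supp {X : Type*} [TopologicalSpace X] (A : X → ℝ) : Set X := closure {x | 0 < A x}

/-- The `g`-cut `[A]_α^g = {x ∈ supp A : g (A x) ≥ α}`. -/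
def gcut {X : Type*} [TopologicalSpace X] (g : ℝ → ℝ) (A : X → ℝ) (α : ℝ) : Set X :=
  {x | x ∈ supp A ∧ α ≤ g (A x)}

/-- `A ∈ F(X)`: an upper semicontinuous fuzzy set on `X`. -/
def IsFuzzy {X : Type*} [TopologicalSpace X] (A : X → ℝ) : Prop :=
  UpperSemicontinuous A ∧ ∀ x, A x ∈ I01

/-- `A ∈ F_0(X)`: a nonempty (not identically 0) upper semicontinuous fuzzy set. -/
def InF0 {X : Type*} [TopologicalSpace X] (A : X → ℝ) : Prop := IsFuzzy A ∧ ∃ x, A x ≠ 0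

/-- `A ∈ F^1(X)`: an upper semicontinuous fuzzy set attaining the value 1. -/
def InF1 {X : Type*} [TopologicalSpace X] (A : X → ℝ) : Prop := IsFuzzy A ∧ ∃ x, 1 ≤ A x

/-- The `g`-fuzzification `f̃_g(A)(x) = sup {g (A y) : y ∈ f⁻¹(x)}` (with `sup ∅ = 0`). -/
def fuzz {X : Type*} (f : X → X) (g : ℝ → ℝ) (A : X → ℝ) : X → ℝ :=
  fun x => sSup ((fun y => g (A y)) '' (f ⁻¹' {x}))

open Classical in
/-- Hausdorff metric, extended by `d_H(∅,∅) = 0` and `d_H(∅,A) = diam X`. -/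
def dH {X : Type*} [MetricSpace X] (A B : Set X) : ℝ :=
  if A = ∅ ∧ B = ∅ then 0
  else if A = ∅ ∨ B = ∅ then Metric.diam (Set.univ : Set X)
  else Metric.hausdorffDist A B

/-- The levelwise metric `d_∞(A,B) = sup {d_H([A]_α, [B]_α) : α ∈ (0,1]}`. -/
def dInfty {X : Type*} [MetricSpace X] (A B : X → ℝ) : ℝ :=
  sSup ((fun α => dH (cut A α) (cut B α)) '' Set.Ioc (0:ℝ) 1)

/-- `K(X)`: the hyperspace of nonempty compact subsets of `X`. -/
def Kc (X : Type*) [MetricSpace X] : Set (Set X) := {A | IsCompact A ∧ A.Nonempty}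

section Dyn

variable {Y : Type*}

/-- `U` is a (relatively) open subset of the space `(S, ρ)`. -/
def IsOpenIn (S : Set Y) (ρ : Y → Y → ℝ) (U : Set Y) : Prop :=
  U ⊆ S ∧ ∀ x ∈ U, ∃ ε > 0, ∀ y ∈ S, ρ x y < ε → y ∈ U

/-- Diameter of a set with respect to the distance function `ρ`. -/
def diamIn (ρ : Y → Y → ℝ) (U : Set Y) : ℝ := sSup (Set.image2 ρ U U)

/-- Sensitive dependence on initial conditions of `T` on the space `(S, ρ)`. -/
def SensitiveOn (S : Set Y) (ρ : Y → Y → ℝ) (T : Y → Y) : Prop :=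
  ∃ δ > 0, ∀ x ∈ S, ∀ ε > 0, ∃ y ∈ S, ρ x y < ε ∧ ∃ n : ℕ, δ < ρ (T^[n] x) (T^[n] y)

/-- `𝓕`-sensitivity of `T` on the space `(S, ρ)`. -/
def FSensitiveOn (S : Set Y) (ρ : Y → Y → ℝ) (T : Y → Y) (F : Set (Set ℕ)) : Prop :=
  ∃ ε > 0, ∀ U : Set Y, IsOpenIn S ρ U → U.Nonempty →
    {n : ℕ | ε < diamIn ρ (T^[n] '' U)} ∈ F

/-- Multi-sensitivity of `T` on the space `(S, ρ)`. -/
def MultiSensitiveOn (S : Set Y) (ρ : Y → Y → ℝ) (T : Y → Y) : Prop :=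
  ∃ ε > 0, ∀ (k : ℕ) (U : Fin k → Set Y),
    (∀ i, IsOpenIn S ρ (U i) ∧ (U i).Nonempty) →
    ∃ n : ℕ, ∀ i, ε < diamIn ρ (T^[n] '' U i)

/-- Topological transitivity of `T` on the space `(S, ρ)`. -/
def TransitiveOn (S : Set Y) (ρ : Y → Y → ℝ) (T : Y → Y) : Prop :=
  ∀ U V : Set Y, IsOpenIn S ρ U → U.Nonempty → IsOpenIn S ρ V → V.Nonempty →
    ∃ n : ℕ, ((T^[n] '' U) ∩ V).Nonempty

/-- Weak mixing: `T × T` is transitive on `(S × S, max-metric)`. -/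
def WeaklyMixingOn (S : Set Y) (ρ : Y → Y → ℝ) (T : Y → Y) : Prop :=
  TransitiveOn (S ×ˢ S) (fun p q => max (ρ p.1 q.1) (ρ p.2 q.2)) (Prod.map T T)

end Dyn

/-- A (proper) Furstenberg family on `ℤ⁺ = ℕ`. -/
def FurstenbergFamily (F : Set (Set ℕ)) : Prop :=
  (∀ F1 F2 : Set ℕ, F1 ∈ F → F1 ⊆ F2 → F2 ∈ F) ∧ Set.univ ∈ F ∧ ∅ ∉ F

/-- The indicator of `{1}` among the elements of `D_m(I)`. -/
def topStep (t : ℝ) : ℝ := if 1 ≤ t then 1 else 0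

lemma topStep_nonneg (t : ℝ) : 0 ≤ topStep t := by
  unfold topStep; split_ifs <;> norm_num

lemma topStep_le_one (t : ℝ) : topStep t ≤ 1 := by
  unfold topStep; split_ifs <;> norm_num

lemma dm_topStep : Dm topStep := by
  refine ⟨?_, ?_, fun t _ => ⟨topStep_nonneg t, topStep_le_one t⟩, by simp [topStep],
    by simp [topStep]⟩
  · intro s _ t _ hst
    by_cases hs : 1 ≤ s
    · simp [topStep, hs, hs.trans hst]
    · simpa [topStep, hs] using topStep_nonneg t
  · intro x hx
    rcases hx.2.lt_or_eq with hlt | rfl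
    · have h : topStep =ᶠ[nhds x] fun _ => (0 : ℝ) := by
        filter_upwards [Iio_mem_nhds hlt] with t ht
        simpa [topStep] using ht
      exact (continuousAt_const.congr h.symm).continuousWithinAt
    · have h : I01 ∩ Set.Ici (1 : ℝ) = {1} := by
        ext t
        simp only [I01, Set.mem_inter_iff, Set.mem_Icc, Set.mem_Ici, Set.mem_singleton_iff]
        constructor
        · intro h; linarith
        · rintro rfl; norm_num
      rw [h]
      exact continuousWithinAt_singleton

/-- The `topStep`-fuzzification takes only the values `0` and `1`. -/
lemma one_le_fuzz_topStep {X : Type*} {f : X → X} {A : X → ℝ} {x : X}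
    (h : 0 < fuzz f topStep A x) : 1 ≤ fuzz f topStep A x := by
  obtain ⟨_, ⟨y, hy, rfl⟩, hpos⟩ : ∃ v ∈ (fun y => topStep (A y)) '' (f ⁻¹' {x}), 0 < v := by
    by_contra! hle
    exact h.not_ge (Real.sSup_nonpos hle)
  have hval : topStep (A y) = 1 := by
    by_contra hne
    have : ¬ 1 ≤ A y := fun hA => hne (by simp [topStep, hA])
    simp [topStep, this] at hpos
  have hbdd : BddAbove ((fun y => topStep (A y)) '' (f ⁻¹' {x})) := by
    refine ⟨1, ?_⟩
    rintro _ ⟨z, _, rfl⟩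
    exact topStep_le_one _
  exact hval.symm.le.trans (le_csSup hbdd ⟨y, hy, rfl⟩)

section Levelwise

variable {X : Type*} [MetricSpace X]

lemma InF1.cut_nonempty {A : X → ℝ} (hA : InF1 A) {α : ℝ} (hα : α ≤ 1) : (cut A α).Nonempty :=
  let ⟨x, hx⟩ := hA.2
  ⟨x, hα.trans hx⟩

lemma dH_eq_hausdorffDist {A B : Set X} (hA : A.Nonempty) (hB : B.Nonempty) :
    dH A B = hausdorffDist A B := by
  simp [dH, hA.ne_empty, hB.ne_empty]

/-- Elements of `F^1(X)` whose `α`-cut lies well inside the ball of radius `R` about `a`. -/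
def cutInside (a : X) (R α : ℝ) : Set (X → ℝ) :=
  {A | InF1 A ∧ ∃ r < R, ∀ x, α ≤ A x → dist x a ≤ r}

/-- Elements of `F^1(X)` whose `α`-cut leaves the closed ball of radius `R` about `a`. -/
def cutLeaves (a : X) (R α : ℝ) : Set (X → ℝ) :=
  {A | InF1 A ∧ ∃ x, α ≤ A x ∧ R < dist x a}

lemma disjoint_cutInside_cutLeaves (a : X) (R α : ℝ) :
    Disjoint (cutInside a R α) (cutLeaves a R α) := by
  rw [Set.disjoint_left]
  rintro A ⟨_, r, hr, hcut⟩ ⟨_, x, hx, hR⟩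
  have := hcut x hx
  linarith

variable [CompactSpace X]

lemma isBounded_of_compactSpace (A : Set X) : Bornology.IsBounded A :=
  isCompact_univ.isBounded.subset (Set.subset_univ A)

lemma hausdorffEDist_ne_top {A B : Set X} (hA : A.Nonempty) (hB : B.Nonempty) :
    hausdorffEDist A B ≠ ⊤ :=
  hausdorffEDist_ne_top_of_nonempty_of_bounded hA hB (isBounded_of_compactSpace A)
    (isBounded_of_compactSpace B)

lemma hausdorffDist_cut_le_dInfty {A B : X → ℝ} (hA : InF1 A) (hB : InF1 B) {α : ℝ}
    (hα : α ∈ Set.Ioc (0 : ℝ) 1) : hausdorffDist (cut A α) (cut B α) ≤ dInfty A B := by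
  rw [← dH_eq_hausdorffDist (hA.cut_nonempty hα.2) (hB.cut_nonempty hα.2)]
  refine le_csSup ⟨diam (Set.univ : Set X), ?_⟩ ⟨α, hα, rfl⟩
  rintro _ ⟨β, hβ, rfl⟩
  have hA' := hA.cut_nonempty hβ.2
  have hB' := hB.cut_nonempty hβ.2
  simp only [dH_eq_hausdorffDist hA' hB']
  exact (hausdorffDist_le_diam hA' (isBounded_of_compactSpace _) hB'
    (isBounded_of_compactSpace _)).trans
      (diam_mono (Set.subset_univ _) (isBounded_of_compactSpace _))

lemma exists_mem_cut_dist_lt {A B : X → ℝ} (hA : InF1 A) (hB : InF1 B) {α ε : ℝ}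
    (hα : α ∈ Set.Ioc (0 : ℝ) 1) (h : dInfty A B < ε) {x : X} (hx : α ≤ A x) :
    ∃ y, α ≤ B y ∧ dist x y < ε :=
  exists_dist_lt_of_hausdorffDist_lt (show x ∈ cut A α from hx)
    ((hausdorffDist_cut_le_dInfty hA hB hα).trans_lt h)
    (hausdorffEDist_ne_top (hA.cut_nonempty hα.2) (hB.cut_nonempty hα.2))

lemma exists_mem_cut_dist_lt' {A B : X → ℝ} (hA : InF1 A) (hB : InF1 B) {α ε : ℝ}
    (hα : α ∈ Set.Ioc (0 : ℝ) 1) (h : dInfty A B < ε) {y : X} (hy : α ≤ B y) :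
    ∃ x, α ≤ A x ∧ dist x y < ε :=
  exists_dist_lt_of_hausdorffDist_lt' (show y ∈ cut B α from hy)
    ((hausdorffDist_cut_le_dInfty hA hB hα).trans_lt h)
    (hausdorffEDist_ne_top (hA.cut_nonempty hα.2) (hB.cut_nonempty hα.2))

lemma isOpenIn_cutInside (a : X) (R : ℝ) {α : ℝ} (hα : α ∈ Set.Ioc (0 : ℝ) 1) :
    IsOpenIn {A : X → ℝ | InF1 A} dInfty (cutInside a R α) := by
  refine ⟨fun A hA => hA.1, ?_⟩
  rintro A ⟨hA, r, hr, hcut⟩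
  refine ⟨(R - r) / 2, by linarith, fun B hB hd => ⟨hB, (R + r) / 2, by linarith, fun y hy => ?_⟩⟩
  obtain ⟨x, hx, hxy⟩ := exists_mem_cut_dist_lt' hA hB hα hd hy
  have := hcut x hx
  have := dist_triangle_left y a x
  linarith

lemma isOpenIn_cutLeaves (a : X) (R : ℝ) {α : ℝ} (hα : α ∈ Set.Ioc (0 : ℝ) 1) :
    IsOpenIn {A : X → ℝ | InF1 A} dInfty (cutLeaves a R α) := by
  refine ⟨fun A hA => hA.1, ?_⟩
  rintro A ⟨hA, x, hx, hR⟩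
  refine ⟨dist x a - R, by linarith, fun B hB hd => ⟨hB, ?_⟩⟩
  obtain ⟨y, hy, hxy⟩ := exists_mem_cut_dist_lt hA hB hα hd hx
  have := dist_triangle x y a
  exact ⟨y, hy, by linarith⟩

end Levelwise

lemma IsOpenIn.inter {Y : Type*} {S : Set Y} {ρ : Y → Y → ℝ} {U V : Set Y}
    (hU : IsOpenIn S ρ U) (hV : IsOpenIn S ρ V) : IsOpenIn S ρ (U ∩ V) := by
  refine ⟨fun x hx => hU.1 hx.1, fun x hx => ?_⟩
  obtain ⟨ε, hε, h⟩ := hU.2 x hx.1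
  obtain ⟨δ, hδ, h'⟩ := hV.2 x hx.2
  exact ⟨min ε δ, lt_min hε hδ, fun y hy hxy =>
    ⟨h y hy (hxy.trans_le (min_le_left _ _)), h' y hy (hxy.trans_le (min_le_right _ _))⟩⟩

lemma IsOpenIn.prod {Y : Type*} {S : Set Y} {ρ : Y → Y → ℝ} {U V : Set Y}
    (hU : IsOpenIn S ρ U) (hV : IsOpenIn S ρ V) :
    IsOpenIn (S ×ˢ S) (fun p q => max (ρ p.1 q.1) (ρ p.2 q.2)) (U ×ˢ V) := by
  refine ⟨Set.prod_mono hU.1 hV.1, fun p hp => ?_⟩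
  obtain ⟨ε, hε, h⟩ := hU.2 p.1 hp.1
  obtain ⟨δ, hδ, h'⟩ := hV.2 p.2 hp.2
  refine ⟨min ε δ, lt_min hε hδ, fun q hq hpq => ?_⟩
  rw [max_lt_iff, lt_min_iff, lt_min_iff] at hpq
  exact ⟨h q.1 hq.1 hpq.1.1, h' q.2 hq.2 hpq.2.2⟩

lemma WeaklyMixingOn.transitiveOn {Y : Type*} {S : Set Y} {ρ : Y → Y → ℝ} {T : Y → Y}
    (h : WeaklyMixingOn S ρ T) : TransitiveOn S ρ T := by
  intro U V hU hUne hV hVne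
  obtain ⟨n, _, ⟨p, hp, rfl⟩, hq⟩ :=
    h _ _ (hU.prod hU) (hUne.prod hUne) (hV.prod hV) (hVne.prod hVne)
  rw [Prod.map_iterate] at hq
  exact ⟨n, T^[n] p.1, ⟨p.1, hp.1, rfl⟩, hq.1⟩

/-- A function into the unit interval with finitely many nonzero values, one of which is `1`, lies
in `F^1(X)`. -/
lemma inF1_of_finite_support {X : Type*} [TopologicalSpace X] [T1Space X] {A : X → ℝ}
    (hI : ∀ x, A x ∈ I01) (hfin : {x | 0 < A x}.Finite) (h1 : ∃ x, 1 ≤ A x) : InF1 A := by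
  refine ⟨⟨upperSemicontinuous_iff_isClosed_preimage.2 fun y => ?_, hI⟩, h1⟩
  rcases le_or_gt y 0 with hy | hy
  · convert isClosed_univ
    exact Set.eq_univ_of_forall fun x => hy.trans (hI x).1
  · exact (hfin.subset fun x hx => hy.trans_le hx).isClosed

open Classical in
lemma not_transitiveOn_fuzz_topStep {X : Type*} [MetricSpace X] [CompactSpace X] {a b : X}
    (hab : a ≠ b) (f : X → X) :
    ¬ TransitiveOn {A : X → ℝ | InF1 A} dInfty (fuzz f topStep) := by
  intro h
  have hD : 0 < dist b a := dist_pos.2 hab.symm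
  set R := dist b a / 2 with hR
  have hhalf : (1 / 2 : ℝ) ∈ Set.Ioc (0 : ℝ) 1 := by norm_num
  have hone : (1 : ℝ) ∈ Set.Ioc (0 : ℝ) 1 := by norm_num
  have hUne : (cutInside a R (1 / 2)).Nonempty := by
    refine ⟨fun x => if x = a then 1 else 0, inF1_of_finite_support ?_ ?_ ⟨a, by simp⟩, 0,
      by linarith, fun x hx => ?_⟩
    · intro x
      by_cases hx : x = a <;> simp [hx, I01]
    · refine (Set.finite_singleton a).subset fun x hx => ?_
      by_contra hxa
      simp_all
    · by_cases hxa : x = a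
      · simp [hxa]
      · simp only [hxa, if_false] at hx
        norm_num at hx
  have hVne : (cutInside a R 1 ∩ cutLeaves a R (1 / 2)).Nonempty := by
    have hB : InF1 fun x : X => if x = a then (1 : ℝ) else if x = b then 1 / 2 else 0 := by
      refine inF1_of_finite_support ?_ ?_ ⟨a, by simp⟩
      · intro x
        dsimp only [I01]
        split_ifs <;> norm_num
      · refine (Set.toFinite {a, b}).subset fun x hx => ?_
        by_contra hxab
        simp_all
    refine ⟨_, ⟨hB, 0, by linarith, fun x hx => ?_⟩, hB, b, by simp [hab.symm], by linarith⟩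
    by_cases hxa : x = a
    · simp [hxa]
    · rw [if_neg hxa] at hx
      split_ifs at hx <;> norm_num at hx
  obtain ⟨n, _, ⟨A, hA, rfl⟩, hB⟩ := h _ _ (isOpenIn_cutInside a R hhalf) hUne
    ((isOpenIn_cutInside a R hone).inter (isOpenIn_cutLeaves a R hhalf)) hVne
  cases n with
  | zero => exact Set.disjoint_left.1 (disjoint_cutInside_cutLeaves a R (1 / 2)) hA hB.2
  | succ n =>
    rw [Function.iterate_succ_apply'] at hB
    obtain ⟨⟨hF, r, hr, hcut⟩, _, x, hx, hxR⟩ := hB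
    have := hcut x (one_le_fuzz_topStep (by linarith))
    linarith

/-- There exists `g ∈ D_m(I)` such that for every dynamical
system `(X,f)` with `X` nontrivial, `f̃_g` is not transitive on
`(F^1(X), d_∞)`, and consequently not weakly mixing. -/
theorem stmt19 :
    ∃ g : ℝ → ℝ, Dm g ∧
      ∀ (X : Type*) [MetricSpace X] [CompactSpace X],
        (∃ a b : X, a ≠ b) → ∀ f : X → X, Continuous f →
          ¬ TransitiveOn {A : X → ℝ | InF1 A} dInfty (fuzz f g) ∧
          ¬ WeaklyMixingOn {A : X → ℝ | InF1 A} dInfty (fuzz f g) := by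
  refine ⟨topStep, dm_topStep, ?_⟩
  rintro X _ _ ⟨a, b, hab⟩ f -
  exact ⟨not_transitiveOn_fuzz_topStep hab f,
    fun h => not_transitiveOn_fuzz_topStep hab f h.transitiveOn⟩
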